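/- Let n ≥ 3, let z_1, …, z_{n−1} be pairwise distinct complex numbers, and let ρ = 1 or ρ = −1. Then there exist n×n complex matrices L_1, …, L_{n−1} and an n×n matrix Q(z) whose entries are polynomials in z, such that the matrix function W(z) = Σ_{k=1}^{n−1} L_k/(z−z_k) + Q(z) satisfies W′(z) = ρ·A(z)·W(z) for all z ∈ ℂ ∖ {z_1, …, z_{n−1}}, and det W(z) ≠ 0 for at least one z ∈ ℂ ∖ {z_1, …, z_{n−1}}. -/

import Mathlib

open Matrix

/-- The n×n complex permutation matrix of the transposition (a b). -/
noncomputable def permP (n : ℕ) (a b : Fin n) : Matrix (Fin n) (Fin n) ℂ :=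
  Matrix.of fun i j => if i = Equiv.swap a b j then 1 else 0

/-- P_k = P(1,k+1) for 1 ≤ k ≤ n-1: with 0-based indices, the transposition (0, k+1). -/
noncomputable def Pk (n : ℕ) [NeZero n] (k : Fin (n - 1)) : Matrix (Fin n) (Fin n) ℂ :=
  permP n 0 ⟨k.1 + 1, by have := k.2; omega⟩

/-- A(z) = Σ_{k=1}^{n-1} P_k / (z - z_k). -/
noncomputable def Amat (n : ℕ) [NeZero n] (z : Fin (n - 1) → ℂ) (w : ℂ) :
    Matrix (Fin n) (Fin n) ℂ :=
  ∑ k : Fin (n - 1), (w - z k)⁻¹ • Pk n k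

open Polynomial in
theorem aux_antideriv (p : ℂ[X]) (w : ℂ) : ∃ G : ℂ[X], derivative G = p ∧ G.eval w = 0 := by
  have h : ∃ G : ℂ[X], derivative G = p := by
    induction p using Polynomial.induction_on' with
    | add p q hp hq =>
      obtain ⟨a, ha⟩ := hp
      obtain ⟨b, hb⟩ := hq
      exact ⟨a + b, by simp [ha, hb]⟩
    | monomial n a =>
      refine ⟨monomial (n + 1) (a / (n + 1)), ?_⟩
      rw [derivative_monomial_succ]
      have : (n : ℂ) + 1 ≠ 0 := by exact_mod_cast n.succ_ne_zero
      rw [div_mul_cancel₀ _ this]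
  obtain ⟨G, hG⟩ := h
  exact ⟨G - C (G.eval w), by simp [hG], by simp⟩

open Polynomial in
theorem aux_pf {m : ℕ} (z : Fin m → ℂ) (hz : Function.Injective z) (N : ℂ[X]) :
    ∃ (l : Fin m → ℂ) (q : ℂ[X]), ∀ u : ℂ, (∀ k, u ≠ z k) →
      (∑ k, (u - z k)⁻¹ * l k) + q.eval u = N.eval u / ∏ k, (u - z k) := by
  obtain ⟨q, r, hr, hf⟩ := eq_quo_mul_prod_add_sum_rem_mul_prod N (s := Finset.univ)
    (g := fun k => X - C (z k)) (fun k _ => monic_X_sub_C _)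
    (fun i _ j _ hij => pairwise_coprime_X_sub_C hz hij)
  have hr' : ∀ k, r k = C ((r k).coeff 0) := fun k => by
    apply eq_C_of_degree_le_zero
    have := hr k (Finset.mem_univ k)
    rw [degree_X_sub_C] at this
    by_cases h0 : r k = 0
    · simp [h0]
    · rw [degree_eq_natDegree h0] at this ⊢
      have h1 : (r k).natDegree < 1 := by exact_mod_cast this
      have h2 : (r k).natDegree = 0 := by omega
      simp [h2]
  refine ⟨fun k => (r k).coeff 0, q, fun u hu => ?_⟩
  have hu' : ∀ k, u - z k ≠ 0 := fun k => sub_ne_zero.mpr (hu k)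
  have hP : ∏ k, (u - z k) ≠ 0 := Finset.prod_ne_zero_iff.mpr fun k _ => hu' k
  rw [eq_div_iff hP, hf, add_mul, Finset.sum_mul, add_comm]
  simp only [eval_add, eval_mul, eval_prod, eval_finsetSum, eval_sub, eval_X, eval_C]
  congr 1
  refine Finset.sum_congr rfl fun k _ => ?_
  have h1 : (r k).eval u = (r k).coeff 0 := by
    conv_lhs => rw [hr' k]
    simp
  rw [← Finset.mul_prod_erase Finset.univ _ (Finset.mem_univ k), h1]
  field_simp [hu' k]

open Polynomial in
theorem aux_core {m : ℕ} (z : Fin m → ℂ) (ρ : ℂ) (hρ : ρ = 1 ∨ ρ = -1)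
    (w0 : ℂ) (hw0 : ∀ k, w0 ≠ z k) (t : Fin (m + 1) → ℂ) :
    ∃ N : Fin (m + 1) → ℂ[X],
      (∀ i, (N i).eval w0 = t i * ∏ k, (w0 - z k)) ∧
      ∀ w, (∀ k, w ≠ z k) →
        (derivative (N 0)).eval w - (N 0).eval w * ∑ k, (w - z k)⁻¹ =
          ρ * ∑ k : Fin m, (w - z k)⁻¹ * (N k.succ).eval w ∧
        ∀ k : Fin m, (derivative (N k.succ)).eval w - (N k.succ).eval w * ∑ k, (w - z k)⁻¹ =
          ρ * ((∑ k, (w - z k)⁻¹) * (N k.succ).eval w +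
            (w - z k)⁻¹ * ((N 0).eval w - (N k.succ).eval w)) := by
  classical
  set P : ℂ[X] := ∏ k, (X - C (z k)) with hP
  set R : Fin m → ℂ[X] := fun k => ∏ l ∈ Finset.univ.erase k, (X - C (z l)) with hR
  have hPR : ∀ k, P = (X - C (z k)) * R k := fun k =>
    (Finset.mul_prod_erase Finset.univ _ (Finset.mem_univ k)).symm
  have hdP : derivative P = ∑ k, R k := by
    rw [hP, derivative_prod_finset]; simp [hR]
  have hPe : ∀ w, P.eval w = ∏ k, (w - z k) := fun w => by simp [hP, eval_prod]
  have hRe : ∀ w, (∀ k, w ≠ z k) → ∀ k, (R k).eval w = P.eval w * (w - z k)⁻¹ := fun w hw k => by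
    have : w - z k ≠ 0 := sub_ne_zero.mpr (hw k)
    rw [hPR k]; simp; field_simp
  have hdPe : ∀ w, (∀ k, w ≠ z k) →
      (derivative P).eval w = P.eval w * ∑ k, (w - z k)⁻¹ := fun w hw => by
    rw [hdP, eval_finsetSum, Finset.mul_sum]
    exact Finset.sum_congr rfl fun k _ => hRe w hw k
  have hdRe : ∀ w, (∀ k, w ≠ z k) → ∀ k, (derivative (R k)).eval w =
      P.eval w * (w - z k)⁻¹ * (∑ k, (w - z k)⁻¹ - (w - z k)⁻¹) := fun w hw k => by
    have h0 : w - z k ≠ 0 := sub_ne_zero.mpr (hw k)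
    have h1 := hdPe w hw
    have h2 : (derivative P).eval w = (R k).eval w + (w - z k) * (derivative (R k)).eval w := by
      conv_lhs => rw [hPR k]
      simp
    rw [h2, hRe w hw k] at h1
    have h3 : (derivative (R k)).eval w =
      (w - z k)⁻¹ * ((w - z k) * (derivative (R k)).eval w) := by field_simp
    rw [h3, eq_sub_of_add_eq' h1]
    ring
  have hp0 : P.eval w0 ≠ 0 := by
    rw [hPe]; exact Finset.prod_ne_zero_iff.mpr fun k _ => sub_ne_zero.mpr (hw0 k)
  rcases hρ with rfl | rfl
  · set p0 := P.eval w0 with hp0d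
    let v : Fin (m + 1) → ℂ := fun i => t i / p0
    let c : Fin m → ℂ := fun k => v k.succ * (w0 - z k)
    let K : ℂ := v 0 + ∑ k : Fin m, v k.succ
    obtain ⟨G, hG, hG0⟩ := aux_antideriv (C K * P - ∑ k, C (c k) * R k) w0
    have hGe : ∀ w, (∀ k, w ≠ z k) → (derivative G).eval w =
        P.eval w * (K - ∑ k, c k * (w - z k)⁻¹) := fun w hw => by
      rw [hG, mul_sub, Finset.mul_sum]
      simp only [eval_sub, eval_mul, eval_C, eval_finsetSum]
      congr 1
      · ring
      · exact Finset.sum_congr rfl fun k _ => by rw [hRe w hw k]; ring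
    refine ⟨Fin.cons (P * derivative G - derivative P * G)
      (fun k => R k * (G + C (c k) * P)), ?_, ?_⟩
    · intro i
      rw [← hPe, ← hp0d]
      refine Fin.cases ?_ (fun k => ?_) i
      · simp only [Fin.cons_zero, eval_sub, eval_mul, hG0, hGe w0 hw0]
        have : ∑ k, c k * (w0 - z k)⁻¹ = ∑ k : Fin m, v k.succ :=
          Finset.sum_congr rfl fun k _ => by
            have : w0 - z k ≠ 0 := sub_ne_zero.mpr (hw0 k)
            simp only [c]; field_simp
        rw [this]
        simp only [K, v]
        rw [← hp0d]
        field_simp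
        ring
      · simp only [Fin.cons_succ, eval_add, eval_mul, hG0, hRe w0 hw0, eval_C]
        have : w0 - z k ≠ 0 := sub_ne_zero.mpr (hw0 k)
        simp only [c, v]
        rw [← hp0d]
        field_simp
        ring
    · intro w hw
      have e1 := hdPe w hw
      have e2 := hGe w hw
      have e3 : (derivative (derivative P)).eval w = P.eval w *
          ((∑ k, (w - z k)⁻¹) * (∑ k, (w - z k)⁻¹) - ∑ k, (w - z k)⁻¹ * (w - z k)⁻¹) := by
        rw [hdP, derivative_sum, eval_finsetSum, Finset.sum_mul, ← Finset.sum_sub_distrib,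
          Finset.mul_sum]
        exact Finset.sum_congr rfl fun k _ => by rw [hdRe w hw k]; ring
      have e4 : (derivative (derivative G)).eval w = P.eval w *
          (K * (∑ k, (w - z k)⁻¹) - (∑ k, c k * (w - z k)⁻¹) * (∑ k, (w - z k)⁻¹)
            + ∑ k, c k * (w - z k)⁻¹ * (w - z k)⁻¹) := by
        have : (derivative (derivative G)).eval w = K * (P.eval w * ∑ k, (w - z k)⁻¹) -
            ∑ k, c k * (derivative (R k)).eval w := by
          rw [hG]; simp [eval_finsetSum, e1]
        have h2 : ∑ k, c k * (derivative (R k)).eval w =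
            P.eval w * ((∑ k, c k * (w - z k)⁻¹) * (∑ k, (w - z k)⁻¹)
              - ∑ k, c k * (w - z k)⁻¹ * (w - z k)⁻¹) := by
          rw [Finset.sum_mul, ← Finset.sum_sub_distrib, Finset.mul_sum]
          exact Finset.sum_congr rfl fun k _ => by rw [hdRe w hw k]; ring
        rw [this, h2]
        ring
      constructor
      · have e5 : ∑ k : Fin m, (w - z k)⁻¹ * ((R k * (G + C (c k) * P)).eval w) =
            P.eval w * (∑ k, (w - z k)⁻¹ * (w - z k)⁻¹) * G.eval w +
            P.eval w ^ 2 * ∑ k, c k * (w - z k)⁻¹ * (w - z k)⁻¹ := by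
          rw [Finset.mul_sum, Finset.sum_mul, Finset.mul_sum, ← Finset.sum_add_distrib]
          refine Finset.sum_congr rfl fun k _ => ?_
          simp only [eval_mul, eval_add, eval_C, hRe w hw k]
          ring
        simp only [Fin.cons_zero, Fin.cons_succ]
        rw [e5]
        simp only [derivative_mul, derivative_sub, eval_sub, eval_add, eval_mul, e1, e2, e3, e4]
        ring
      · intro k
        simp only [Fin.cons_zero, Fin.cons_succ, derivative_mul, derivative_add, derivative_C,
          eval_sub, eval_add, eval_mul, eval_C, eval_zero, e1, e2, hRe w hw k, hdRe w hw k]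
        ring
  · let v : Fin (m + 1) → ℂ := fun i => t i * P.eval w0
    let c : Fin m → ℂ := fun k => (v k.succ - v 0) / (w0 - z k)
    let a : ℂ := - (∑ k, c k) / P.eval w0
    obtain ⟨F, hF, hF0⟩ := aux_antideriv P w0
    choose H hH hH0 using fun k => aux_antideriv (R k) w0
    let q : Fin m → ℂ[X] := fun k => C (c k) - C a * H k
    let V : ℂ[X] := C (v 0) + C a * F
    have hcon : C a * P = - ∑ k, q k := by
      have h1 : derivative (P - ∑ k, H k) = 0 := by
        rw [derivative_sub, derivative_sum, hdP]; simp [hH]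
      have h2 := eq_C_of_derivative_eq_zero h1
      have h3 : P - ∑ k, H k = C (P.eval w0) := by
        have h4 := congrArg (eval w0) h2
        rw [h2]
        simp only [eval_sub, eval_finsetSum, hH0, Finset.sum_const_zero, sub_zero, eval_C] at h4
        rw [h4]
      have h5 : C a * C (P.eval w0) = - ∑ k, C (c k) := by
        rw [← C_mul, ← map_sum, ← C_neg]
        congr 1
        simp only [a]; field_simp
      simp only [q, Finset.sum_sub_distrib, ← Finset.mul_sum]
      rw [sub_eq_iff_eq_add.mp h3, mul_add, h5]
      ring
    refine ⟨Fin.cons V (fun k => V + (X - C (z k)) * q k), ?_, ?_⟩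
    · intro i
      rw [← hPe]
      refine Fin.cases ?_ (fun k => ?_) i
      · simp [V, hF0, v]
      · have : w0 - z k ≠ 0 := sub_ne_zero.mpr (hw0 k)
        simp only [Fin.cons_succ, V, q, eval_add, eval_mul, eval_sub, eval_X, eval_C, hF0, hH0, c]
        field_simp
        simp [v]
    · intro w hw
      have hdV : derivative V = C a * P := by simp [V, hF]
      constructor
      · simp only [Fin.cons_zero, Fin.cons_succ]
        rw [hdV, hcon]
        simp only [eval_neg, eval_finsetSum, eval_add, eval_mul, eval_sub, eval_X, eval_C]
        rw [Finset.mul_sum, Finset.mul_sum, ← Finset.sum_neg_distrib, ← Finset.sum_sub_distrib]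
        refine Finset.sum_congr rfl fun k _ => ?_
        have : w - z k ≠ 0 := sub_ne_zero.mpr (hw k)
        field_simp
        ring
      · intro k
        have : w - z k ≠ 0 := sub_ne_zero.mpr (hw k)
        have hd : derivative (V + (X - C (z k)) * q k) = q k := by
          have : derivative (q k) = - (C a * R k) := by simp [q, hH]
          simp only [derivative_add, derivative_mul, hdV, this, derivative_sub, derivative_X,
            derivative_C]
          rw [hPR k]; ring
        simp only [Fin.cons_zero, Fin.cons_succ]
        rw [hd]
        simp only [eval_add, eval_mul, eval_sub, eval_X, eval_C]
        field_simp
        ring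

theorem aux_Pk_mul {m : ℕ} (k : Fin m) (M : Matrix (Fin (m + 1)) (Fin (m + 1)) ℂ) (i j) :
    (Pk (m + 1) k * M) i j = M (Equiv.swap 0 k.succ i) j := by
  have : Pk (m + 1) k = permP (m + 1) 0 k.succ := rfl
  rw [this, Matrix.mul_apply, Finset.sum_eq_single (Equiv.swap 0 k.succ i)]
  · simp [permP]
  · intro b _ hb
    have : i ≠ Equiv.swap 0 k.succ b := fun h => hb (by rw [h]; simp)
    simp [permP, this]
  · simp

theorem aux_A_zero {m : ℕ} (z : Fin m → ℂ) (w : ℂ)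
    (M : Matrix (Fin (m + 1)) (Fin (m + 1)) ℂ) (j) :
    (Amat (m + 1) z w * M) 0 j = ∑ k : Fin m, (w - z k)⁻¹ * M k.succ j := by
  unfold Amat
  rw [Finset.sum_mul, Matrix.sum_apply]
  refine Finset.sum_congr rfl fun k _ => ?_
  rw [Matrix.smul_mul, Matrix.smul_apply, aux_Pk_mul, Equiv.swap_apply_left, smul_eq_mul]

theorem aux_A_succ {m : ℕ} (z : Fin m → ℂ) (w : ℂ)
    (M : Matrix (Fin (m + 1)) (Fin (m + 1)) ℂ) (k : Fin m) (j) :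
    (Amat (m + 1) z w * M) k.succ j = (∑ k : Fin m, (w - z k)⁻¹) * M k.succ j +
      (w - z k)⁻¹ * (M 0 j - M k.succ j) := by
  have h : (Amat (m + 1) z w * M) k.succ j = ∑ l : Fin m, ((w - z l)⁻¹ * M k.succ j +
      if l = k then (w - z k)⁻¹ * (M 0 j - M k.succ j) else 0) := by
    unfold Amat
    rw [Finset.sum_mul, Matrix.sum_apply]
    refine Finset.sum_congr rfl fun l _ => ?_
    rw [Matrix.smul_mul, Matrix.smul_apply, aux_Pk_mul, smul_eq_mul]
    by_cases hl : l = k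
    · subst hl
      rw [Equiv.swap_apply_right, if_pos rfl]
      ring
    · rw [Equiv.swap_apply_of_ne_of_ne (Fin.succ_ne_zero k)
        (fun h => hl (Fin.succ_injective _ h).symm), if_neg hl, add_zero]
  rw [h, Finset.sum_add_distrib, Finset.sum_mul]
  simp

/-- For n ≥ 3, pairwise distinct z₁,…,z_{n-1} and ρ = ±1, the KZ equation
W' = ρ·A(z)·W has a rational fundamental solution of the form
W(z) = Σ_k L_k/(z - z_k) + Q(z) with Q a matrix polynomial and det W(z) ≠ 0
at some point of ℂ ∖ {z₁,…,z_{n-1}}.  Derivatives are entrywise. -/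
theorem rational_fundamental_solution (n : ℕ) [NeZero n] (hn : 3 ≤ n)
    (z : Fin (n - 1) → ℂ) (hz : Function.Injective z)
    (ρ : ℂ) (hρ : ρ = 1 ∨ ρ = -1) :
    ∃ (L : Fin (n - 1) → Matrix (Fin n) (Fin n) ℂ)
      (Q : Matrix (Fin n) (Fin n) (Polynomial ℂ))
      (W : ℂ → Matrix (Fin n) (Fin n) ℂ),
      (∀ u : ℂ, W u = (∑ k : Fin (n - 1), (u - z k)⁻¹ • L k)
          + Matrix.of fun i j => (Q i j).eval u) ∧
      (∀ w : ℂ, (∀ k, w ≠ z k) → ∀ i j,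
        HasDerivAt (fun u => W u i j) ((ρ • (Amat n z w * W w)) i j) w) ∧
      (∃ w : ℂ, (∀ k, w ≠ z k) ∧ (W w).det ≠ 0) := by
  obtain ⟨m, rfl⟩ : ∃ m, n = m + 1 := ⟨n - 1, by omega⟩
  change Fin m → ℂ at z
  change ∃ (L : Fin m → Matrix (Fin (m + 1)) (Fin (m + 1)) ℂ)
      (Q : Matrix (Fin (m + 1)) (Fin (m + 1)) (Polynomial ℂ))
      (W : ℂ → Matrix (Fin (m + 1)) (Fin (m + 1)) ℂ),
      (∀ u : ℂ, W u = (∑ k : Fin m, (u - z k)⁻¹ • L k)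
          + Matrix.of fun i j => (Q i j).eval u) ∧
      (∀ w : ℂ, (∀ k : Fin m, w ≠ z k) → ∀ i j,
        HasDerivAt (fun u => W u i j) ((ρ • (Amat (m + 1) z w * W w)) i j) w) ∧
      (∃ w : ℂ, (∀ k : Fin m, w ≠ z k) ∧ (W w).det ≠ 0)
  obtain ⟨w0, hw0⟩ : ∃ w0 : ℂ, ∀ k, w0 ≠ z k := by
    obtain ⟨w, hw⟩ := (Set.finite_range z).exists_notMem
    exact ⟨w, fun k h => hw ⟨k, h.symm⟩⟩
  choose N hN0 hN using fun j : Fin (m + 1) =>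
    aux_core z ρ hρ w0 hw0 (fun i => if i = j then 1 else 0)
  choose l q hlq using fun i j : Fin (m + 1) => aux_pf z hz (N j i)
  let W : ℂ → Matrix (Fin (m + 1)) (Fin (m + 1)) ℂ := fun u =>
    (∑ k : Fin m, (u - z k)⁻¹ • (Matrix.of fun i j => l i j k)) +
      Matrix.of fun i j => (q i j).eval u
  have hW : ∀ u, (∀ k, u ≠ z k) → ∀ i j, W u i j = (N j i).eval u / ∏ k, (u - z k) := by
    intro u hu i j
    rw [← hlq i j u hu]
    simp [W, Matrix.sum_apply]
  refine ⟨_, _, W, fun u => rfl, ?_, w0, hw0, ?_⟩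
  · intro w hw i j
    have hev : (fun u => W u i j) =ᶠ[nhds w] fun u => (N j i).eval u / ∏ k, (u - z k) := by
      have : ∀ᶠ u in nhds w, ∀ k, u ≠ z k :=
        Filter.eventually_all.mpr fun k => isOpen_ne.mem_nhds (hw k)
      filter_upwards [this] with u hu using hW u hu i j
    refine HasDerivAt.congr_of_eventuallyEq ?_ hev
    have hne : ∀ k, w - z k ≠ 0 := fun k => sub_ne_zero.mpr (hw k)
    have hP : ∏ k, (w - z k) ≠ 0 := Finset.prod_ne_zero_iff.mpr fun k _ => hne k
    have hdP : HasDerivAt (fun u => ∏ k, (u - z k))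
        ((∏ k, (w - z k)) * ∑ k, (w - z k)⁻¹) w := by
      have := HasDerivAt.fun_finsetProd (u := Finset.univ) (f := fun k u => u - z k)
        (f' := fun _ => 1) (x := w) (fun k _ => (hasDerivAt_id w).sub_const (z k))
      refine this.congr_deriv ?_
      symm
      rw [Finset.mul_sum]
      refine Finset.sum_congr rfl fun k _ => ?_
      rw [← Finset.mul_prod_erase Finset.univ _ (Finset.mem_univ k)]
      have := hne k
      simp only [smul_eq_mul, mul_one]
      field_simp
    refine (((N j i).hasDerivAt w).div hdP hP).congr_deriv ?_
    symm
    have key : (Polynomial.derivative (N j i)).eval w - (N j i).eval w * ∑ k, (w - z k)⁻¹ =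
        ρ * (Amat (m + 1) z w * W w) i j * ∏ k, (w - z k) := by
      obtain ⟨h0, hs⟩ := hN j w hw
      refine Fin.cases ?_ (fun k => ?_) i
      · rw [h0, mul_assoc]
        congr 1
        refine Eq.trans ?_ (congrArg (· * _) (aux_A_zero z w (W w) j).symm)
        rw [Finset.sum_mul]
        refine Finset.sum_congr rfl fun k _ => ?_
        rw [hW w hw]
        field_simp
      · rw [hs k, mul_assoc]
        congr 1
        refine Eq.trans ?_ (congrArg (· * _) (aux_A_succ z w (W w) k j).symm)
        simp only [hW w hw]
        field_simp
    rw [Matrix.smul_apply, smul_eq_mul, eq_div_iff (pow_ne_zero 2 hP)]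
    linear_combination (-∏ k, (w - z k)) * key
  · have : W w0 = 1 := by
      ext i j
      have hP : ∏ k, (w0 - z k) ≠ 0 :=
        Finset.prod_ne_zero_iff.mpr fun k _ => sub_ne_zero.mpr (hw0 k)
      rw [hW w0 hw0, hN0, mul_div_cancel_right₀ _ hP, Matrix.one_apply]
    rw [this]; simp
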